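/- (Exponential rate, KL exponent α = 1.) Let x̃ ∈ ℝ^d and set w_k = f(x_k) − f(x̃). Suppose for all k ≥ N_1: x_{k+1} = x_k − η_k ∇f(x_k) with a ≤ η_k ≤ 1/L for some a > 0, w_k ≥ 0, and ‖∇f(x_k)‖^2 ≥ 2μ w_k with μ > 0; suppose also x_k → x̃ as k → ∞. Set Q = a μ (assume Q < 1). Then for all k ≥ N_1, ‖x_k − x̃‖ ≤ C_1 e^{−Qk/2}, where C_1 = 2 √(2 e^{Q N_1} w_{N_1} / μ). -/

import Mathlib

/-- The descent lemma: a function with `L`-Lipschitz gradient lies below its quadratic model. -/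
theorem le_quadratic_of_lipschitz_gradient
    {E : Type*} [NormedAddCommGroup E] [InnerProductSpace ℝ E] [CompleteSpace E]
    {f : E → ℝ} (hf : Differentiable ℝ f) {L : ℝ}
    (hLip : ∀ y z, ‖gradient f y - gradient f z‖ ≤ L * ‖y - z‖) (x v : E) :
    f (x + v) ≤ f x + inner ℝ (gradient f x) v + L / 2 * ‖v‖ ^ 2 := by
  let ψ : ℝ → ℝ := fun t ↦
    f (x + t • v) - t * inner ℝ (gradient f x) v - L / 2 * ‖v‖ ^ 2 * t ^ 2
  have hψ (t : ℝ) : HasDerivAt ψ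
      (inner ℝ (gradient f (x + t • v)) v - inner ℝ (gradient f x) v - L * ‖v‖ ^ 2 * t) t := by
    have hline : HasDerivAt (fun s : ℝ ↦ x + s • v) v t := by
      simpa using ((hasDerivAt_id t).smul_const v).const_add x
    have hcomp := (hf (x + t • v)).hasGradientAt.hasFDerivAt.comp_hasDerivAt t hline
    rw [InnerProductSpace.toDual_apply_apply] at hcomp
    refine ((hcomp.sub ((hasDerivAt_id t).mul_const _)).sub
      ((hasDerivAt_pow 2 t).const_mul (L / 2 * ‖v‖ ^ 2))).congr_deriv ?_
    norm_num
    ring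
  have hanti : AntitoneOn ψ (Set.Icc 0 1) := by
    refine antitoneOn_of_deriv_nonpos (convex_Icc 0 1)
      (fun t _ ↦ (hψ t).continuousAt.continuousWithinAt)
      (fun t _ ↦ (hψ t).differentiableAt.differentiableWithinAt) fun t ht ↦ ?_
    rw [interior_Icc] at ht
    rw [(hψ t).deriv, ← inner_sub_left, sub_nonpos]
    calc inner ℝ (gradient f (x + t • v) - gradient f x) v
        ≤ ‖gradient f (x + t • v) - gradient f x‖ * ‖v‖ := real_inner_le_norm _ _
      _ ≤ L * ‖x + t • v - x‖ * ‖v‖ := by gcongr; exact hLip _ _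
      _ = L * ‖v‖ ^ 2 * t := by
        rw [add_sub_cancel_left, norm_smul, Real.norm_of_nonneg ht.1.le]
        ring
  have h := hanti (Set.left_mem_Icc.2 zero_le_one) (Set.right_mem_Icc.2 zero_le_one) zero_le_one
  simp only [ψ, zero_smul, one_smul, add_zero] at h
  linarith

/-- A gradient step of length at most `1 / L` decreases the function by at least half of the
step size times the squared norm of the gradient. -/
theorem gradient_step_decrease
    {E : Type*} [NormedAddCommGroup E] [InnerProductSpace ℝ E] [CompleteSpace E]
    {f : E → ℝ} (hf : Differentiable ℝ f) {L : ℝ} (hL : 0 < L)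
    (hLip : ∀ y z, ‖gradient f y - gradient f z‖ ≤ L * ‖y - z‖) (x : E) {η : ℝ}
    (hη : 0 ≤ η) (hηL : η ≤ 1 / L) :
    f (x - η • gradient f x) ≤ f x - η / 2 * ‖gradient f x‖ ^ 2 := by
  have h := le_quadratic_of_lipschitz_gradient hf hLip x (-(η • gradient f x))
  rw [← sub_eq_add_neg, inner_neg_right, inner_smul_right, real_inner_self_eq_norm_sq, norm_neg,
    norm_smul, Real.norm_of_nonneg hη] at h
  have hLη : η * L ≤ 1 := (le_div_iff₀ hL).1 hηL
  nlinarith [mul_nonneg (mul_nonneg hη (sq_nonneg ‖gradient f x‖)) (sub_nonneg.2 hLη)]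

/-- If `w` drops by at least `η / 2 * g ^ 2` and `2 * μ * w ≤ g ^ 2`, then the step length `η * g`
is controlled by the drop of `√(2 * w / μ)`. -/
theorem mul_le_two_mul_sqrt_sub_sqrt {μ w w' η g : ℝ} (hμ : 0 < μ) (hw : 0 ≤ w) (hw' : 0 ≤ w')
    (hη : 0 ≤ η) (hg : 0 ≤ g) (hdec : w' ≤ w - η / 2 * g ^ 2) (hKL : 2 * μ * w ≤ g ^ 2) :
    η * g ≤ 2 * (√(2 * w / μ) - √(2 * w' / μ)) := by
  have hle : w' ≤ w := hdec.trans (sub_le_self _ (by positivity))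
  have hmono : √(2 * w' / μ) ≤ √(2 * w / μ) := by gcongr
  rcases hg.eq_or_lt with rfl | hgpos
  · linarith
  have hv : √(2 * w / μ) ≤ g / μ := by
    refine Real.sqrt_le_iff.2 ⟨by positivity, ?_⟩
    rw [div_pow, div_le_div_iff₀ hμ (by positivity)]
    nlinarith
  have hdiff : η * g * (g / μ) ≤ √(2 * w / μ) ^ 2 - √(2 * w' / μ) ^ 2 := by
    rw [Real.sq_sqrt (by positivity), Real.sq_sqrt (by positivity), ← sub_div, ← mul_div_assoc]
    gcongr
    linarith
  refine le_of_mul_le_mul_right ?_ (div_pos hgpos hμ)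
  nlinarith [mul_nonneg (sub_nonneg.2 hmono) (sub_nonneg.2 hv),
    mul_nonneg (sub_nonneg.2 hmono) (sub_nonneg.2 (hmono.trans hv))]

/-- If the steps of a convergent sequence are bounded by the decrements of a nonnegative sequence
`v`, then `v` bounds the distance to the limit. -/
theorem norm_sub_le_of_norm_step_le_sub {E : Type*} [NormedAddCommGroup E] {x : ℕ → E} {l : E}
    {v : ℕ → ℝ} {k : ℕ} (hlim : Filter.Tendsto x Filter.atTop (nhds l)) (hv : ∀ n, 0 ≤ v n)
    (hstep : ∀ n, k ≤ n → ‖x (n + 1) - x n‖ ≤ v n - v (n + 1)) :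
    ‖x k - l‖ ≤ v k := by
  have hbound (n : ℕ) (hn : k ≤ n) : ‖x k - x n‖ ≤ v k - v n := by
    induction n, hn using Nat.le_induction with
    | base => simp
    | succ n hn ih =>
      have h := norm_sub_le_norm_sub_add_norm_sub (x k) (x n) (x (n + 1))
      rw [norm_sub_rev (x n)] at h
      linarith [hstep n hn]
  refine le_of_tendsto (hlim.const_sub (x k)).norm ?_
  filter_upwards [Filter.eventually_ge_atTop k] with n hn
  linarith [hbound n hn, hv n]

/-- Exponential rate under the KL condition with exponent `α = 1`: with `Q = aμ < 1`,
`‖x_k − x̃‖ ≤ C₁ e^{−Qk/2}` for all `k ≥ N₁`, where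
`C₁ = 2√(2 e^{Q N₁} w_{N₁}/μ)`. -/
theorem KL_exponential_rate
    {d : ℕ} (hd : 1 ≤ d)
    (f : EuclideanSpace ℝ (Fin d) → ℝ) (hf : Differentiable ℝ f)
    (L : ℝ) (hL : 0 < L)
    (hLip : ∀ y z, ‖gradient f y - gradient f z‖ ≤ L * ‖y - z‖)
    (x : ℕ → EuclideanSpace ℝ (Fin d)) (η : ℕ → ℝ) (N₁ : ℕ)
    (xt : EuclideanSpace ℝ (Fin d))
    (a μ : ℝ) (ha : 0 < a) (hμ : 0 < μ)
    (hstep : ∀ k : ℕ, N₁ ≤ k → x (k + 1) = x k - η k • gradient f (x k))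
    (hηlow : ∀ k : ℕ, N₁ ≤ k → a ≤ η k)
    (hηup : ∀ k : ℕ, N₁ ≤ k → η k ≤ 1 / L)
    (hw : ∀ k : ℕ, N₁ ≤ k → 0 ≤ f (x k) - f xt)
    (hKL : ∀ k : ℕ, N₁ ≤ k → 2 * μ * (f (x k) - f xt) ≤ ‖gradient f (x k)‖ ^ 2)
    (hlim : Filter.Tendsto x Filter.atTop (nhds xt))
    (hQ : a * μ < 1) :
    ∀ k : ℕ, N₁ ≤ k →
      ‖x k - xt‖ ≤ 2 * Real.sqrt (2 * Real.exp (a * μ * N₁) * (f (x N₁) - f xt) / μ)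
        * Real.exp (-(a * μ * k) / 2) := by
  have hη (k : ℕ) (hk : N₁ ≤ k) : 0 ≤ η k := ha.le.trans (hηlow k hk)
  have hdec (k : ℕ) (hk : N₁ ≤ k) :
      f (x (k + 1)) - f xt ≤ f (x k) - f xt - η k / 2 * ‖gradient f (x k)‖ ^ 2 := by
    have h := gradient_step_decrease hf hL hLip (x k) (hη k hk) (hηup k hk)
    rw [← hstep k hk] at h
    linarith
  have hdecay (k : ℕ) (hk : N₁ ≤ k) :
      f (x k) - f xt ≤ Real.exp (a * μ * N₁ - a * μ * k) * (f (x N₁) - f xt) := by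
    induction k, hk using Nat.le_induction with
    | base => simp
    | succ k hk ih =>
      calc f (x (k + 1)) - f xt ≤ (-(a * μ) + 1) * (f (x k) - f xt) := by
            have h : a * (2 * μ * (f (x k) - f xt)) ≤ η k * ‖gradient f (x k)‖ ^ 2 :=
              mul_le_mul (hηlow k hk) (hKL k hk)
                (mul_nonneg (by positivity) (hw k hk)) (hη k hk)
            linarith [hdec k hk]
        _ ≤ Real.exp (-(a * μ)) * (f (x k) - f xt) :=
            mul_le_mul_of_nonneg_right (Real.add_one_le_exp _) (hw k hk)
        _ ≤ Real.exp (-(a * μ)) *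
              (Real.exp (a * μ * N₁ - a * μ * k) * (f (x N₁) - f xt)) := by gcongr
        _ = Real.exp (a * μ * N₁ - a * μ * (k + 1 : ℕ)) * (f (x N₁) - f xt) := by
            rw [← mul_assoc, ← Real.exp_add]
            push_cast
            ring_nf
  intro k hk
  have hdist : ‖x k - xt‖ ≤ 2 * √(2 * (f (x k) - f xt) / μ) := by
    refine norm_sub_le_of_norm_step_le_sub (v := fun n ↦ 2 * √(2 * (f (x n) - f xt) / μ)) hlim
      (fun n ↦ by positivity) fun n hn ↦ ?_
    have hn' : N₁ ≤ n := hk.trans hn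
    rw [hstep n hn', sub_sub_cancel_left, norm_neg, norm_smul, Real.norm_of_nonneg (hη n hn'),
      ← hstep n hn', ← mul_sub]
    exact mul_le_two_mul_sqrt_sub_sqrt hμ (hw n hn') (hw (n + 1) (by lia)) (hη n hn')
      (norm_nonneg _) (hdec n hn') (hKL n hn')
  refine hdist.trans ?_
  rw [mul_assoc, Real.exp_half, ← Real.sqrt_mul' _ (Real.exp_pos _).le]
  gcongr 2 * √?_
  calc 2 * (f (x k) - f xt) / μ
      ≤ 2 * (Real.exp (a * μ * N₁ - a * μ * k) * (f (x N₁) - f xt)) / μ := by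
        gcongr
        exact hdecay k hk
    _ = 2 * Real.exp (a * μ * N₁) * (f (x N₁) - f xt) / μ * Real.exp (-(a * μ * k)) := by
        rw [sub_eq_add_neg, Real.exp_add]
        ring
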